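/- Let $k$ be a field of characteristic $p > 0$ and $R = k[x,y,z]$ the polynomial ring in three variables. Let $M_1$ be the cokernel of the $R$-linear map $R \to R^{p+1}$, $1 \mapsto (x^{p(p-1)}, x^{p(p-2)}y, \dots, x^{p(p-1-j)}y^{j}, \dots, y^{p-1}, z)$, and $M_2$ the cokernel of the map $R \to R^{p+1}$ given by the same vector except with the entry $y^{p-1}$ replaced by $(1+x)y^{p-1}$. Then $M_1$ and $M_2$ are reflexive $R$-modules of rank $p$ with $M_1 \oplus R \cong M_2 \oplus R$, but $M_1$ and $M_2$ are not isomorphic as $R$-modules. -/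

import Mathlib

open TensorProduct MvPolynomial

/-- The polynomial ring `k[x,y,z]`. -/
abbrev R3 (k : Type) [Field k] : Type := MvPolynomial (Fin 3) k

/-- The cokernel of `R → R^m`, `1 ↦ v`. -/
abbrev CokerVec (k : Type) [Field k] (m : ℕ) (v : Fin m → R3 k) : Type :=
  (Fin m → R3 k) ⧸ Submodule.span (R3 k) {v}

/-- The vector `(x^{p(p-1)}, x^{p(p-2)}y, …, y^{p-1}, z)`. -/
noncomputable def wvec1 (k : Type) [Field k] (p : ℕ) : Fin (p + 1) → R3 k :=
  fun i => if (i : ℕ) < p then (X 0) ^ (p * (p - 1 - (i : ℕ))) * (X 1) ^ (i : ℕ)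
    else X 2

/-- The same vector with the entry `y^{p-1}` replaced by `(1+x)y^{p-1}`. -/
noncomputable def wvec2 (k : Type) [Field k] (p : ℕ) : Fin (p + 1) → R3 k :=
  fun i => if (i : ℕ) = p - 1 then (1 + X 0) * (X 1) ^ (p - 1) else wvec1 k p i


section General
set_option linter.unusedSectionVars false
variable {R : Type} [CommRing R] [IsDomain R] {n : ℕ}

/-- Koszul functional on the cokernel. -/
noncomputable def kosz (v : Fin n → R) (i j : Fin n) :
    Module.Dual R ((Fin n → R) ⧸ Submodule.span R {v}) :=
  Submodule.liftQ _ (v i • LinearMap.proj j - v j • LinearMap.proj i) (by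
    rw [Submodule.span_le]
    rintro _ rfl
    simp [mul_comm])

lemma kosz_mk (v : Fin n → R) (i j : Fin n) (h : Fin n → R) :
    kosz v i j (Submodule.Quotient.mk h) = v i * h j - v j * h i := by
  simp [kosz]

lemma dual_ext' (v : Fin n → R) (f g : Module.Dual R ((Fin n → R) ⧸ Submodule.span R {v}))
    (H : ∀ h : Fin n → R, f (Submodule.Quotient.mk h) = g (Submodule.Quotient.mk h)) : f = g := by
  ext x
  exact H _

lemma kosz_cyc (v : Fin n → R) (i j l : Fin n) :
    v l • kosz v i j + v i • kosz v j l - v j • kosz v i l = 0 := by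
  apply dual_ext'
  intro h
  simp [kosz_mk]
  ring

lemma dual_mk (v : Fin n → R) (ψ : Module.Dual R ((Fin n → R) ⧸ Submodule.span R {v}))
    (h : Fin n → R) : ψ (Submodule.Quotient.mk h) =
      ∑ j, h j * ψ (Submodule.Quotient.mk (Pi.single j 1)) := by
  have := LinearMap.pi_apply_eq_sum_univ (ψ ∘ₗ Submodule.mkQ (Submodule.span R {v})) h
  simp only [LinearMap.comp_apply, Submodule.mkQ_apply, smul_eq_mul] at this
  rw [this]
  refine Finset.sum_congr rfl fun j _ => ?_
  congr 3
  ext i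
  simp [Pi.single_apply, eq_comm]

lemma dual_expand (v : Fin n → R) (i : Fin n)
    (ψ : Module.Dual R ((Fin n → R) ⧸ Submodule.span R {v})) :
    v i • ψ = ∑ j, ψ (Submodule.Quotient.mk (Pi.single j 1)) • kosz v i j := by
  have h0 : ∑ j, v j * ψ (Submodule.Quotient.mk (Pi.single j 1)) = 0 := by
    rw [← dual_mk, (Submodule.Quotient.mk_eq_zero _).2 (Submodule.mem_span_singleton_self v),
      map_zero]
  apply dual_ext'
  intro h
  simp only [LinearMap.smul_apply, LinearMap.sum_apply, kosz_mk, smul_eq_mul, mul_sub,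
    Finset.sum_sub_distrib]
  rw [dual_mk, Finset.mul_sum]
  have : ∑ j, ψ (Submodule.Quotient.mk (Pi.single j 1)) * (v j * h i) = 0 := by
    rw [← mul_zero (h i), ← h0, Finset.mul_sum]
    exact Finset.sum_congr rfl fun j _ => by ring
  rw [this, sub_zero]
  exact Finset.sum_congr rfl fun j _ => by ring

lemma coker_reflexive (v : Fin n → R) (o q l : Fin n) (h0 : v o ≠ 0)
    (h1 : ∀ x, v o ∣ v q * x → v o ∣ x)
    (h2 : ∀ x s r, v l * x = v o * s + v q * r → ∃ s' r', x = v o * s' + v q * r') :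
    Module.IsReflexive R ((Fin n → R) ⧸ Submodule.span R {v}) := by
  constructor
  constructor
  · rw [injective_iff_map_eq_zero]
    intro m hm
    induction m using Submodule.Quotient.induction_on with
    | H h =>
    have key : ∀ j, v o * h j = v j * h o := fun j => by
      have := LinearMap.congr_fun hm (kosz v o j)
      simp only [Module.Dual.eval_apply, kosz_mk, LinearMap.zero_apply] at this
      exact sub_eq_zero.1 this
    obtain ⟨c, hc⟩ := h1 (h o) ⟨h q, (key q).symm⟩
    rw [Submodule.Quotient.mk_eq_zero, Submodule.mem_span_singleton]
    refine ⟨c, ?_⟩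
    ext j
    apply mul_left_cancel₀ h0
    rw [key, hc]
    simp; ring
  · intro φ
    have cyc : ∀ i j l, v l * φ (kosz v i j) + v i * φ (kosz v j l) - v j * φ (kosz v i l) = 0 := by
      intro i j l
      have := congrArg φ (kosz_cyc v i j l)
      simpa using this
    obtain ⟨s, r, hsr⟩ := h2 (φ (kosz v o q)) (- φ (kosz v q l)) (φ (kosz v o l))
      (by linear_combination cyc o q l)
    have ex : ∀ j, ∃ t, φ (kosz v o j) = v o * t - v j * (-r) := by
      intro j
      obtain ⟨t, ht⟩ := h1 (φ (kosz v o j) - v j * r) ⟨v j * s + φ (kosz v q j), by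
        linear_combination (-1) * cyc o q j + v j * hsr⟩
      exact ⟨t, by linear_combination ht⟩
    choose t ht using ex
    have hoo : kosz v o o = 0 := by
      apply dual_ext'; intro h; simp [kosz_mk]
    have hto : t o = -r := by
      have := ht o
      rw [hoo, map_zero] at this
      apply mul_left_cancel₀ h0
      linear_combination -this
    refine ⟨Submodule.Quotient.mk t, ?_⟩
    ext ψ
    rw [Module.Dual.eval_apply]
    apply mul_left_cancel₀ h0
    have e1 := congrArg φ (dual_expand v o ψ)
    have e2 := LinearMap.congr_fun (dual_expand v o ψ) (Submodule.Quotient.mk t)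
    simp only [map_smul, map_sum, LinearMap.smul_apply, LinearMap.sum_apply, smul_eq_mul] at e1 e2
    rw [e1, e2]
    refine Finset.sum_congr rfl fun j _ => ?_
    rw [ht, kosz_mk, hto]

lemma coker_rank (v : Fin (n+1) → R) (hv : v ≠ 0) :
    Module.rank (FractionRing R)
      (FractionRing R ⊗[R] ((Fin (n+1) → R) ⧸ Submodule.span R {v})) = n := by
  rw [(TensorProduct.isBaseChange R ((Fin (n+1) → R) ⧸ Submodule.span R {v})
    (FractionRing R)).rank_eq]
  have h := rank_quotient_add_rank_of_isDomain (Submodule.span R {v})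
  rw [← (LinearEquiv.toSpanNonzeroSingleton R (Fin (n+1) → R) v hv).rank_eq, Module.rank_self,
    rank_fin_fun] at h
  push_cast at h
  exact Cardinal.eq_of_add_eq_add_right h Cardinal.one_lt_aleph0

lemma coker_stable (v1 v2 : Fin n → R) (o q : Fin n) (hoq : o ≠ q) (u w c : R)
    (huw : u * w = 1 + c * v1 o) (hq : v2 q = u * v1 q) (hne : ∀ j, j ≠ q → v2 j = v1 j) :
    Nonempty ((((Fin n → R) ⧸ Submodule.span R {v1}) × R) ≃ₗ[R]
      (((Fin n → R) ⧸ Submodule.span R {v2}) × R)) := by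
  let a := v1 o
  let b := v1 q
  let F : ((Fin n → R) × R) →ₗ[R] ((Fin n → R) × R) :=
    { toFun := fun x => (Function.update x.1 q (u * x.1 q + c * a * x.2),
        x.1 q + w * x.2 - w * (u * x.1 q + c * a * x.2) + c * b * x.1 o)
      map_add' := by
        intro x y
        ext j
        · by_cases h : j = q
          · subst h; simp; ring
          · simp [h]
        · simp; ring
      map_smul' := by
        intro r x
        ext j
        · by_cases h : j = q
          · subst h; simp; ring
          · simp [h]
        · simp; ring }
  let G : ((Fin n → R) × R) → ((Fin n → R) × R) := fun y =>
    (Function.update y.1 q (w * y.1 q - c * a * (y.2 + w * y.1 q - c * b * y.1 o)),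
      - y.1 q + u * (y.2 + w * y.1 q - c * b * y.1 o))
  have FG : ∀ y, F (G y) = y := by
    intro y
    ext j
    · by_cases h : j = q
      · subst h; simp [F, G]; linear_combination (y.1 j) * huw
      · simp [F, G, h]
    · simp [F, G, hoq]; linear_combination (y.2 + w * y.1 q - c * b * y.1 o - w * y.1 q) * huw
  have GF : ∀ y, G (F y) = y := by
    intro y
    ext j
    · by_cases h : j = q
      · subst h; simp [F, G, hoq]; linear_combination (y.1 j) * huw
      · simp [F, G, h]
    · simp [F, G, hoq]; linear_combination (y.2) * huw
  have Fv : F (v1, 0) = (v2, 0) := by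
    ext j
    · by_cases h : j = q
      · subst h; simp [F, hq]
      · simp [F, h, hne]
    · simp [F, a, b]; linear_combination (- v1 q) * huw
  let P1 := (Submodule.mkQ (Submodule.span R {v1})).prodMap (LinearMap.id : R →ₗ[R] R)
  let P2 := (Submodule.mkQ (Submodule.span R {v2})).prodMap (LinearMap.id : R →ₗ[R] R)
  have s1 : Function.Surjective P1 :=
    Function.Surjective.prodMap (Submodule.mkQ_surjective _) Function.surjective_id
  have s2 : Function.Surjective (P2 ∘ₗ F) :=
    (Function.Surjective.prodMap (Submodule.mkQ_surjective _) Function.surjective_id).comp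
      (fun y => ⟨G y, FG y⟩)
  have hk : LinearMap.ker P1 = LinearMap.ker (P2 ∘ₗ F) := by
    ext x
    have e1 : ∀ (v : Fin n → R) (x : (Fin n → R) × R),
        (Submodule.mkQ (Submodule.span R {v})).prodMap (LinearMap.id : R →ₗ[R] R) x = 0 ↔
        ∃ t : R, t • (v, (0:R)) = x := by
      intro v x
      rw [LinearMap.prodMap_apply, Prod.mk_eq_zero, Submodule.mkQ_apply,
        Submodule.Quotient.mk_eq_zero, Submodule.mem_span_singleton]
      constructor
      · rintro ⟨⟨t, ht⟩, h⟩
        exact ⟨t, Prod.ext ht (by simpa using h.symm)⟩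
      · rintro ⟨t, rfl⟩
        exact ⟨⟨t, rfl⟩, by simp⟩
    rw [LinearMap.mem_ker, LinearMap.mem_ker, LinearMap.comp_apply, e1, e1, ← Fv]
    refine exists_congr fun t => ?_
    rw [← map_smul]
    exact (Function.LeftInverse.injective GF).eq_iff.symm
  exact ⟨(P1.quotKerEquivOfSurjective s1).symm.trans
    ((Submodule.quotEquivOfEq _ _ hk).trans ((P2 ∘ₗ F).quotKerEquivOfSurjective s2))⟩

lemma dvd_det (v1 v2 : Fin n → R) (o q : Fin n) (h0 : v1 o ≠ 0)
    (h1 : ∀ x, v1 o ∣ v1 q * x → v1 o ∣ x) (A : Matrix (Fin n) (Fin n) R) (a : R) (ha : a ≠ 0)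
    (h : A.mulVec v1 = a • v2) : a ∣ A.det := by
  have e : A.det • v1 = a • (A.adjugate.mulVec v2) := by
    rw [← Matrix.mulVec_smul, ← h, Matrix.mulVec_mulVec, Matrix.adjugate_mul, Matrix.smul_mulVec,
      Matrix.one_mulVec]
  have eo := congrFun e o
  have eq := congrFun e q
  simp only [Pi.smul_apply, smul_eq_mul] at eo eq
  obtain ⟨t, ht⟩ := h1 (A.adjugate.mulVec v2 o) ⟨A.adjugate.mulVec v2 q, by
    apply mul_left_cancel₀ ha
    linear_combination v1 o * eq - v1 q * eo⟩
  refine ⟨t, ?_⟩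
  apply mul_right_cancel₀ h0
  rw [eo, ht]; ring

lemma iso_matrix (v1 v2 : Fin n → R) (o q : Fin n) (h10 : v1 o ≠ 0) (h20 : v2 o ≠ 0)
    (h11 : ∀ x, v1 o ∣ v1 q * x → v1 o ∣ x) (h21 : ∀ x, v2 o ∣ v2 q * x → v2 o ∣ x)
    (hu : ∀ l : Fin n → R, 1 + l ⬝ᵥ v1 ≠ 0)
    (e : ((Fin n → R) ⧸ Submodule.span R {v1}) ≃ₗ[R] ((Fin n → R) ⧸ Submodule.span R {v2})) :
    ∃ (A : Matrix (Fin n) (Fin n) R) (a b d : R) (l : Fin n → R), A.mulVec v1 = a • v2 ∧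
      a * b = 1 + l ⬝ᵥ v1 ∧ A.det = a * d ∧ IsUnit d := by
  obtain ⟨f, hf⟩ := Module.projective_lifting_property (Submodule.mkQ (Submodule.span R {v2}))
    (e.toLinearMap ∘ₗ Submodule.mkQ (Submodule.span R {v1})) (Submodule.mkQ_surjective _)
  obtain ⟨g, hg⟩ := Module.projective_lifting_property (Submodule.mkQ (Submodule.span R {v1}))
    (e.symm.toLinearMap ∘ₗ Submodule.mkQ (Submodule.span R {v2})) (Submodule.mkQ_surjective _)
  have hf' : ∀ x, (Submodule.Quotient.mk (f x) : (Fin n → R) ⧸ Submodule.span R {v2}) =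
      e (Submodule.Quotient.mk x) := fun x => LinearMap.congr_fun hf x
  have hg' : ∀ x, (Submodule.Quotient.mk (g x) : (Fin n → R) ⧸ Submodule.span R {v1}) =
      e.symm (Submodule.Quotient.mk x) := fun x => LinearMap.congr_fun hg x
  obtain ⟨a, ha⟩ : ∃ a : R, a • v2 = f v1 := by
    rw [← Submodule.mem_span_singleton, ← Submodule.Quotient.mk_eq_zero, hf',
      (Submodule.Quotient.mk_eq_zero _).2 (Submodule.mem_span_singleton_self v1), map_zero]
  obtain ⟨b, hb⟩ : ∃ b : R, b • v1 = g v2 := by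
    rw [← Submodule.mem_span_singleton, ← Submodule.Quotient.mk_eq_zero, hg',
      (Submodule.Quotient.mk_eq_zero _).2 (Submodule.mem_span_singleton_self v2), map_zero]
  have hl : ∀ j : Fin n, ∃ c : R, c • v1 = g (f (Pi.single j 1)) - Pi.single j 1 := by
    intro j
    rw [← Submodule.mem_span_singleton, ← Submodule.Quotient.mk_eq_zero,
      Submodule.Quotient.mk_sub, hg', hf', LinearEquiv.symm_apply_apply, sub_self]
  choose l hl using hl
  let A := LinearMap.toMatrix' f
  let B := LinearMap.toMatrix' g
  have hA : ∀ x, A.mulVec x = f x := fun x => by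
    rw [← Matrix.toLin'_apply, Matrix.toLin'_toMatrix']
  have hB : ∀ x, B.mulVec x = g x := fun x => by
    rw [← Matrix.toLin'_apply, Matrix.toLin'_toMatrix']
  have hBA : B * A = 1 + Matrix.replicateCol Unit v1 * Matrix.replicateRow Unit l := by
    apply Matrix.toLin'.injective
    apply LinearMap.pi_ext'
    intro j
    ext i
    have := congrFun (hl j) i
    simp only [LinearMap.comp_apply, Matrix.toLin'_apply, LinearMap.single_apply]
    rw [← Matrix.mulVec_mulVec, hA, hB, Matrix.add_mulVec, Matrix.one_mulVec,
      ← Matrix.mulVec_mulVec]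
    simp [Matrix.mulVec, dotProduct] at this ⊢
    linear_combination -this
  have hdet : B.det * A.det = 1 + l ⬝ᵥ v1 := by
    rw [← Matrix.det_mul, hBA, Matrix.det_one_add_replicateCol_mul_replicateRow]
  have hab : a * b = 1 + l ⬝ᵥ v1 := by
    have e1 : (B * A).mulVec v1 = (a * b) • v1 := by
      rw [← Matrix.mulVec_mulVec, hA, ← ha, Matrix.mulVec_smul, hB, ← hb, smul_smul]
    have e2 : (B * A).mulVec v1 = (1 + l ⬝ᵥ v1) • v1 := by
      rw [hBA, Matrix.add_mulVec, Matrix.one_mulVec]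
      ext i
      simp [Matrix.mulVec, dotProduct, Matrix.mul_apply, mul_assoc, ← Finset.mul_sum]
      ring
    have := congrFun (e1.symm.trans e2) o
    exact mul_right_cancel₀ h10 this
  have hab0 : a * b ≠ 0 := hab ▸ hu l
  obtain ⟨d, hd⟩ := dvd_det v1 v2 o q h10 h11 A a (left_ne_zero_of_mul hab0) (by rw [hA, ha])
  obtain ⟨d', hd'⟩ := dvd_det v2 v1 o q h20 h21 B b (right_ne_zero_of_mul hab0) (by rw [hB, hb])
  refine ⟨A, a, b, d, l, by rw [hA, ha], hab, hd, IsUnit.of_mul_eq_one d' ?_⟩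
  apply mul_left_cancel₀ hab0
  rw [hd, hd', ← hab] at hdet
  linear_combination hdet

end General

section Concrete
variable {k : Type} [Field k]

lemma reg1 (N b : ℕ) (u : R3 k) (hu : MvPolynomial.eval ![(0:k), 1, 0] u = 1) (x : R3 k)
    (h : (X 0 : R3 k) ^ N ∣ (u * X 1 ^ b) * x) : (X 0 : R3 k) ^ N ∣ x := by
  refine Prime.pow_dvd_of_dvd_mul_left (MvPolynomial.X_prime) N ?_ h
  rintro ⟨c, hc⟩
  have := congrArg (MvPolynomial.eval ![(0:k), 1, 0]) hc
  simp [hu] at this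

lemma reg2 (α β : R3 k) (hα : MvPolynomial.aeval ![(X 0 : R3 k), X 1, 0] α = α)
    (hβ : MvPolynomial.aeval ![(X 0 : R3 k), X 1, 0] β = β) (x s r : R3 k)
    (h : X 2 * x = α * s + β * r) : ∃ s' r', x = α * s' + β * r' := by
  have hdiv : ∀ f : R3 k, ∃ c, f = MvPolynomial.aeval ![(X 0 : R3 k), X 1, 0] f + X 2 * c := by
    intro f
    have : (Ideal.Quotient.mkₐ k (Ideal.span {(X 2 : R3 k)})).comp
        (MvPolynomial.aeval ![(X 0 : R3 k), X 1, 0]) =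
        Ideal.Quotient.mkₐ k (Ideal.span {(X 2 : R3 k)}) := by
      apply MvPolynomial.algHom_ext
      intro i
      have hz : (Ideal.Quotient.mk (Ideal.span {(X 2 : R3 k)})) (X 2) = 0 :=
        Ideal.Quotient.eq_zero_iff_mem.2 (Ideal.mem_span_singleton_self _)
      fin_cases i <;> simp [hz]
    have h2 := AlgHom.congr_fun this f
    simp only [AlgHom.comp_apply, Ideal.Quotient.mkₐ_eq_mk] at h2
    have h3 := Ideal.mem_span_singleton.1 (Ideal.Quotient.eq.1 h2.symm)
    obtain ⟨c, hc⟩ := h3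
    exact ⟨c, by linear_combination hc⟩
  obtain ⟨s1, hs⟩ := hdiv s
  obtain ⟨r1, hr⟩ := hdiv r
  refine ⟨s1, r1, ?_⟩
  have h0 := congrArg (MvPolynomial.aeval ![(X 0 : R3 k), X 1, 0]) h
  simp only [map_mul, map_add, hα, hβ, aeval_X] at h0
  simp only [Matrix.cons_val, zero_mul] at h0
  apply mul_left_cancel₀ (MvPolynomial.X_ne_zero (R := k) (2 : Fin 3))
  linear_combination h + α * hs + β * hr - h0

/-- exponents -/
noncomputable def sexp (p : ℕ) (i : Fin (p + 1)) : Fin 3 →₀ ℕ :=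
  if (i : ℕ) < p then Finsupp.single 0 (p * (p - 1 - (i : ℕ))) + Finsupp.single 1 (i : ℕ)
  else Finsupp.single 2 1

lemma wvec1_eq (p : ℕ) (i : Fin (p + 1)) : wvec1 k p i = monomial (sexp p i) 1 := by
  unfold wvec1 sexp
  split_ifs
  · rw [X_pow_eq_monomial, X_pow_eq_monomial, monomial_mul, one_mul]
  · rfl

lemma sexp_not_le (p : ℕ) (hp : 2 ≤ p) (m : ℕ) (hm : m < p) (i j : Fin (p + 1)) (hij : i ≠ j) :
    ¬ sexp p i ≤ Finsupp.single 0 m + sexp p j := by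
  intro h
  have h0 := h 0
  have h1 := h 1
  have h2 := h 2
  have hij' : (i : ℕ) ≠ j := fun h => hij (Fin.ext h)
  have hi := i.2
  have hj := j.2
  unfold sexp at h0 h1 h2
  split_ifs at h0 h1 h2 with hi' hj' hj'
  · simp at h0 h1 h2
    have : (p - 1 - (i:ℕ)) < (p - 1 - (j:ℕ)) + 1 := by
      apply Nat.lt_of_mul_lt_mul_left (a := p)
      rw [Nat.mul_add]
      omega
    omega
  · simp at h0 h1 h2
    rw [h1] at h0
    have : p * 1 ≤ p * (p - 1 - 0) := Nat.mul_le_mul_left _ (by omega)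
    simp at h0 this
    omega
  · simp at h0 h1 h2
  · omega

/-- `x ↦ X`, `y, z ↦ 0`. -/
noncomputable def prx : R3 k →ₐ[k] Polynomial k :=
  MvPolynomial.aeval ![Polynomial.X, 0, 0]

lemma prx_coeff (f : R3 k) (m : ℕ) : (prx f).coeff m = coeff (Finsupp.single 0 m) f := by
  induction f using MvPolynomial.induction_on' with
  | add p q hp hq => simp [hp, hq]
  | monomial s a =>
    rw [coeff_monomial, prx, aeval_monomial, Finsupp.prod_fintype _ _ (by simp),
      Fin.prod_univ_three, Polynomial.algebraMap_eq, Polynomial.coeff_C_mul]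
    simp only [Matrix.cons_val]
    by_cases h1 : s 1 = 0
    · by_cases h2 : s 2 = 0
      · have hs : s = Finsupp.single 0 (s 0) := by
          ext i; fin_cases i <;> simp [h1, h2]
        rw [h1, h2]
        simp only [pow_zero, mul_one, Polynomial.coeff_X_pow]
        by_cases hm : m = s 0
        · rw [if_pos hm, if_pos (by rw [hs, hm]), mul_one]
        · rw [if_neg hm, if_neg, mul_zero]
          intro h; apply hm; rw [h]; simp
      · rw [zero_pow h2, if_neg]
        · simp
        · intro h; apply h2; rw [h]; simp
    · rw [zero_pow h1, if_neg]
      · simp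
      · intro h; apply h1; rw [h]; simp

lemma syz (p : ℕ) (hp : 2 ≤ p) (g : Fin (p + 1) → R3 k) (hg : ∑ i, g i * wvec1 k p i = 0)
    (j : Fin (p + 1)) : (Polynomial.X : Polynomial k) ^ p ∣ prx (g j) := by
  rw [Polynomial.X_pow_dvd_iff]
  intro m hm
  rw [prx_coeff]
  have := congrArg (coeff (Finsupp.single 0 m + sexp p j)) hg
  rw [coeff_sum, Finset.sum_eq_single j] at this
  · simpa [wvec1_eq] using this
  · intro i _ hi
    rw [wvec1_eq, coeff_mul_monomial', if_neg (sexp_not_le p hp m hm i j hi)]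
  · simp

lemma noniso (p : ℕ) (hp : p.Prime) [CharP k p] (A : Matrix (Fin (p+1)) (Fin (p+1)) (R3 k))
    (a b d : R3 k) (l : Fin (p+1) → R3 k) (h1 : A.mulVec (wvec1 k p) = a • wvec2 k p)
    (h2 : a * b = 1 + l ⬝ᵥ wvec1 k p) (h3 : A.det = a * d) (hd : IsUnit d) : False := by
  have h2p := hp.two_le
  have : Fact p.Prime := ⟨hp⟩
  let θ : R3 k →+* (Polynomial k ⧸ Ideal.span {(Polynomial.X : Polynomial k) ^ p}) :=
    (Ideal.Quotient.mk _).comp (prx (k := k)).toRingHom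
  have hθ : ∀ f, θ f = 0 ↔ (Polynomial.X : Polynomial k) ^ p ∣ prx f := by
    intro f
    exact Ideal.Quotient.eq_zero_iff_mem.trans Ideal.mem_span_singleton
  let D : Fin (p+1) → R3 k := fun i => if (i : ℕ) = p - 1 then 1 + X 0 else 1
  have hD : ∀ i, wvec2 k p i = D i * wvec1 k p i := by
    intro i
    simp only [wvec2, D]
    split_ifs with h
    · rw [wvec1, if_pos (by omega), h]; simp
    · simp
  have hA : θ.mapMatrix A = Matrix.diagonal (fun i => θ (a * D i)) := by
    ext i j
    have := syz p h2p (fun j => A i j - if i = j then a * D i else 0) (by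
      have := congrFun h1 i
      simp only [Matrix.mulVec, dotProduct, Pi.smul_apply, hD, smul_eq_mul] at this
      simp only [sub_mul, Finset.sum_sub_distrib, this]
      simp [mul_assoc]) j
    rw [← hθ, map_sub, sub_eq_zero] at this
    simp only [RingHom.mapMatrix_apply, Matrix.map_apply, Matrix.diagonal_apply]
    rw [this]
    split_ifs <;> simp
  have hdet : θ a ^ (p + 1) * θ (1 + X 0) = θ a * θ d := by
    rw [← map_mul, ← h3, RingHom.map_det, hA, Matrix.det_diagonal]
    simp only [map_mul, Finset.prod_mul_distrib, Finset.prod_const, Finset.card_univ,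
      Fintype.card_fin]
    congr 1
    rw [Finset.prod_eq_single (⟨p - 1, by omega⟩ : Fin (p+1))]
    · simp [D]
    · intro i _ hi
      have : (i : ℕ) ≠ p - 1 := fun h => hi (Fin.ext h)
      simp [D, this]
    · simp
  have hv : ∀ i, θ (wvec1 k p i) = 0 := by
    intro i
    rw [hθ, Polynomial.X_pow_dvd_iff]
    intro m hm
    rw [prx_coeff, wvec1_eq, coeff_monomial, if_neg]
    intro h
    have e0 := DFunLike.congr_fun h 0
    have e1 := DFunLike.congr_fun h 1
    have e2 := DFunLike.congr_fun h 2
    unfold sexp at e0 e1 e2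
    split_ifs at e0 e1 e2 with hi
    · simp at e0 e1 e2
      rw [e1] at e0
      have : p * 1 ≤ p * (p - 1 - 0) := Nat.mul_le_mul_left _ (by omega)
      simp at e0 this
      omega
    · simp at e2
  have hab : θ a * θ b = 1 := by
    rw [← map_mul, h2, map_add, map_one, dotProduct, map_sum, Finset.sum_eq_zero, add_zero]
    intro i _
    rw [map_mul, hv, mul_zero]
  have hfin : θ a ^ p * θ (1 + X 0) = θ d := by
    linear_combination θ b * hdet + (θ d - θ a ^ p * θ (1 + X 0)) * hab
  obtain ⟨d0, hd0, rfl⟩ := MvPolynomial.isUnit_iff_eq_C_of_isReduced.1 hd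
  rw [← map_pow, ← map_mul, ← sub_eq_zero, ← map_sub, hθ, Polynomial.X_pow_dvd_iff] at hfin
  obtain ⟨c, hc⟩ : Polynomial.X ∣ prx a - Polynomial.C ((prx a).coeff 0) := by
    rw [Polynomial.X_dvd_iff]; simp
  have hpow : prx a ^ p = Polynomial.C ((prx a).coeff 0 ^ p) + Polynomial.X ^ p * c ^ p := by
    rw [← mul_pow, ← hc, Polynomial.C_pow, ← add_pow_char]
    simp
  have hx : prx (X 0 : R3 k) = Polynomial.X := by simp [prx]
  have hC : prx (C d0 : R3 k) = Polynomial.C d0 := by simp [prx, Polynomial.algebraMap_eq]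
  have c0 := hfin 0 (by omega)
  have c1 := hfin 1 (by omega)
  rw [map_sub, map_mul, map_pow, hpow, map_add, map_one, hx, hC] at c0 c1
  simp only [mul_add, add_mul, mul_one, Polynomial.coeff_sub, Polynomial.coeff_add,
    Polynomial.coeff_C, Polynomial.coeff_C_mul_X, Polynomial.coeff_X_pow_mul',
    Polynomial.coeff_mul_X, Polynomial.coeff_mul_X_zero] at c0 c1
  have hp0 : ¬ p ≤ 0 := by omega
  have hp1 : ¬ p ≤ 1 := by omega
  simp [hp0, hp1, Polynomial.coeff_X_pow_mul'] at c0 c1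
  rw [c1.1, zero_pow hp.ne_zero, zero_sub, neg_eq_zero] at c0
  exact hd0.ne_zero c0

lemma w1o (p : ℕ) (hp : 2 ≤ p) : wvec1 k p 0 = X 0 ^ (p * (p - 1)) := by
  rw [wvec1, if_pos (by simp; omega)]; simp

lemma w1q (p : ℕ) (hp : 2 ≤ p) : wvec1 k p ⟨p - 1, by omega⟩ = 1 * X 1 ^ (p - 1) := by
  rw [wvec1, if_pos (by simp; omega)]; simp

lemma w1l (p : ℕ) : wvec1 k p (Fin.last p) = X 2 := by
  rw [wvec1, if_neg (by simp)]

lemma w2o (p : ℕ) (hp : 2 ≤ p) : wvec2 k p 0 = X 0 ^ (p * (p - 1)) := by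
  rw [wvec2, if_neg (by simp; omega), w1o p hp]

lemma w2q (p : ℕ) (hp : 2 ≤ p) : wvec2 k p ⟨p - 1, by omega⟩ = (1 + X 0) * X 1 ^ (p - 1) := by
  rw [wvec2, if_pos (by simp)]

lemma w2l (p : ℕ) (hp : 2 ≤ p) : wvec2 k p (Fin.last p) = X 2 := by
  rw [wvec2, if_neg (by simp; omega), w1l p]

lemma xpow_ne (N : ℕ) : (X 0 : R3 k) ^ N ≠ 0 := pow_ne_zero _ (MvPolynomial.X_ne_zero _)

lemma w1_eval (p : ℕ) (hp : 2 ≤ p) (i : Fin (p + 1)) :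
    MvPolynomial.constantCoeff (wvec1 k p i) = 0 := by
  rw [wvec1]
  split_ifs with h
  · by_cases hi : (i : ℕ) = 0
    · have e : p * (p - 1 - (i : ℕ)) ≠ 0 := mul_ne_zero (by omega) (by omega)
      rw [map_mul, map_pow, constantCoeff_X, zero_pow e, zero_mul]
    · rw [map_mul, map_pow (n := (i : ℕ)), constantCoeff_X, zero_pow hi, mul_zero]
  · simp

end Concrete
/-- Let `k` be a field of characteristic `p > 0` and `R = k[x,y,z]`.  The cokernels `M₁`,
`M₂` of `1 ↦ (x^{p(p-1)}, x^{p(p-2)}y, …, y^{p-1}, z)` and of the same vector with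
`y^{p-1}` replaced by `(1+x)y^{p-1}` are reflexive `R`-modules of rank `p`, with
`M₁ ⊕ R ≅ M₂ ⊕ R`, but `M₁ ≇ M₂`. -/
theorem char_p_noncancellation (k : Type) [Field k] (p : ℕ) (hp : 0 < p) (hchar : CharP k p) :
    Module.IsReflexive (R3 k) (CokerVec k (p + 1) (wvec1 k p)) ∧
    Module.IsReflexive (R3 k) (CokerVec k (p + 1) (wvec2 k p)) ∧
    Module.rank (FractionRing (R3 k))
      (FractionRing (R3 k) ⊗[R3 k] (CokerVec k (p + 1) (wvec1 k p))) = p ∧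
    Module.rank (FractionRing (R3 k))
      (FractionRing (R3 k) ⊗[R3 k] (CokerVec k (p + 1) (wvec2 k p))) = p ∧
    Nonempty (((CokerVec k (p + 1) (wvec1 k p)) × R3 k) ≃ₗ[R3 k]
      ((CokerVec k (p + 1) (wvec2 k p)) × R3 k)) ∧
    IsEmpty ((CokerVec k (p + 1) (wvec1 k p)) ≃ₗ[R3 k]
      (CokerVec k (p + 1) (wvec2 k p))) := by
  have hprime : p.Prime := by
    rcases CharP.char_is_prime_or_zero k p with h | h
    · exact h
    · omega
  have h2 := hprime.two_le
  have q1 : ∀ x, wvec1 k p 0 ∣ wvec1 k p ⟨p - 1, by omega⟩ * x → wvec1 k p 0 ∣ x := by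
    rw [w1o p h2, w1q p h2]
    exact reg1 _ _ 1 (by simp)
  have q2 : ∀ x, wvec2 k p 0 ∣ wvec2 k p ⟨p - 1, by omega⟩ * x → wvec2 k p 0 ∣ x := by
    rw [w2o p h2, w2q p h2]
    exact reg1 _ _ (1 + X 0) (by simp)
  have n1 : wvec1 k p 0 ≠ 0 := by rw [w1o p h2]; exact xpow_ne _
  have n2 : wvec2 k p 0 ≠ 0 := by rw [w2o p h2]; exact xpow_ne _
  refine ⟨?_, ?_, ?_, ?_, ?_, ?_⟩
  · refine coker_reflexive (wvec1 k p) 0 ⟨p - 1, by omega⟩ (Fin.last p) n1 q1 ?_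
    rw [w1o p h2, w1q p h2, w1l p]
    exact reg2 _ _ (by simp) (by simp)
  · refine coker_reflexive (wvec2 k p) 0 ⟨p - 1, by omega⟩ (Fin.last p) n2 q2 ?_
    rw [w2o p h2, w2q p h2, w2l p h2]
    exact reg2 _ _ (by simp) (by simp)
  · exact coker_rank _ fun h => n1 (congrFun h 0)
  · exact coker_rank _ fun h => n2 (congrFun h 0)
  · refine coker_stable (wvec1 k p) (wvec2 k p) 0 ⟨p - 1, by omega⟩ ?_ (1 + X 0)
      (∑ i ∈ Finset.range (p * (p - 1)), (-X 0) ^ i) (-(-1) ^ (p * (p - 1))) ?_ ?_ ?_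
    · intro h
      have := congrArg Fin.val h
      simp at this
      omega
    · have := mul_neg_geom_sum (-X 0 : R3 k) (p * (p - 1))
      rw [w1o p h2, neg_mul, ← mul_pow, neg_one_mul]
      rw [sub_neg_eq_add] at this
      rw [this, sub_eq_add_neg]
    · rw [w1q p h2, w2q p h2, one_mul]
    · intro j hj
      rw [wvec2, if_neg]
      intro h
      exact hj (Fin.ext h)
  · refine ⟨fun e => ?_⟩
    obtain ⟨A, a, b, d, l, e1, e2, e3, e4⟩ := iso_matrix (wvec1 k p) (wvec2 k p) 0
      ⟨p - 1, by omega⟩ n1 n2 q1 q2 (by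
        intro l h
        have := congrArg (MvPolynomial.constantCoeff) h
        simp [dotProduct, w1_eval p h2] at this) e
    exact noniso p hprime A a b d l e1 e2 e3 e4
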